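/- arXiv:2306.09518 — 3 statements merged into one kernel-verified Lean document; each statement's English description precedes it below -/
import Mathlib

section
/- (Theorem 2, Euclidean-norm version.) Assume: (i) the full score equations have a solution (β̄₀, ζ̄, τ̄) and the reduced score equations have a solution (β̄₀^M, τ̄^M), and the matrix Ω₁₁ is invertible; (ii) Condition A.8 holds with constant K̃ > 0 on a convex set Z containing (β̄₀, ζ̄, τ̄) and (β̄₀^M, 0, τ̄^M). Let M, c₀ > 0, κ ∈ (0, 1/2) and n ≥ 1, and suppose the spectral (operator) norm of Ω₂₂ = E[Z_kᵀ V⁻¹ Z_k] is at most M and ‖E[Z_kᵀ V⁻¹ ((β̄₀·1_m + Z_k ζ̄ + Z_C τ̄) − (β̄₀^M·1_m + Z_C τ̄^M))]‖ ≥ c₀·√m·n^{−κ} in Euclidean norm. Then |L^R| ≥ c₁·m·n^{−2κ}, with c₁ = K̃·c₀²/M². -/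
open MeasureTheory Matrix Real

noncomputable section

/-- The stacked design matrix `[1_m, Z_k, Z_C]`. -/
def stackedFull {m d c : ℕ} (Zk : Matrix (Fin m) (Fin d) ℝ) (ZC : Matrix (Fin m) (Fin c) ℝ) :
    Matrix (Fin m) (Unit ⊕ Fin d ⊕ Fin c) ℝ :=
  Matrix.of fun i j =>
    Sum.elim (fun _ => (1 : ℝ)) (Sum.elim (fun a => Zk i a) (fun b' => ZC i b')) j

/-- The stacked reduced design matrix `[1_m, Z_C]`. -/
def stackedRed {m c : ℕ} (ZC : Matrix (Fin m) (Fin c) ℝ) :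
    Matrix (Fin m) (Unit ⊕ Fin c) ℝ :=
  Matrix.of fun i j => Sum.elim (fun _ => (1 : ℝ)) (fun b' => ZC i b') j

/-- The linear predictor `β₀·1_m + Z_k ζ + Z_C τ`. -/
def pred {m d c : ℕ} (Zk : Matrix (Fin m) (Fin d) ℝ) (ZC : Matrix (Fin m) (Fin c) ℝ)
    (β0 : ℝ) (ζ : Fin d → ℝ) (τ : Fin c → ℝ) : Fin m → ℝ :=
  (fun _ => β0) + Zk.mulVec ζ + ZC.mulVec τ

/-- The Gaussian log-likelihood
`l(θ; y) = −(m/2)·log(2π) − (1/2)·log det V − (1/2)·(y − θ)ᵀ V⁻¹ (y − θ)`. -/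
def loglik {m : ℕ} (V : Matrix (Fin m) (Fin m) ℝ) (θ y : Fin m → ℝ) : ℝ :=
  -((m : ℝ) / 2) * Real.log (2 * Real.pi) - (1 / 2) * Real.log V.det
    - (1 / 2) * ((y - θ) ⬝ᵥ V⁻¹.mulVec (y - θ))

variable {Ωs : Type*} [MeasurableSpace Ωs]

/-- `(β₀, ζ, τ)` solves the full population score equations
`E[[1, Z_k, Z_C]ᵀ V⁻¹ (β₀·1 + Z_k ζ + Z_C τ)] = E[[1, Z_k, Z_C]ᵀ V⁻¹ y]`. -/
def SolvesFull {m d c : ℕ} (Pr : Measure Ωs) (V : Matrix (Fin m) (Fin m) ℝ)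
    (Zk : Ωs → Matrix (Fin m) (Fin d) ℝ) (ZC : Ωs → Matrix (Fin m) (Fin c) ℝ)
    (y : Ωs → Fin m → ℝ) (β0 : ℝ) (ζ : Fin d → ℝ) (τ : Fin c → ℝ) : Prop :=
  ∀ j, (∫ ω, (stackedFull (Zk ω) (ZC ω))ᵀ.mulVec
          (V⁻¹.mulVec (pred (Zk ω) (ZC ω) β0 ζ τ)) j ∂Pr)
      = ∫ ω, (stackedFull (Zk ω) (ZC ω))ᵀ.mulVec (V⁻¹.mulVec (y ω)) j ∂Pr

/-- `(β₀, τ)` solves the reduced population score equations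
`E[[1, Z_C]ᵀ V⁻¹ (β₀·1 + Z_C τ)] = E[[1, Z_C]ᵀ V⁻¹ y]`. -/
def SolvesRed {m c : ℕ} (Pr : Measure Ωs) (V : Matrix (Fin m) (Fin m) ℝ)
    (ZC : Ωs → Matrix (Fin m) (Fin c) ℝ)
    (y : Ωs → Fin m → ℝ) (β0 : ℝ) (τ : Fin c → ℝ) : Prop :=
  ∀ j, (∫ ω, (stackedRed (ZC ω))ᵀ.mulVec
          (V⁻¹.mulVec ((fun _ => β0) + (ZC ω).mulVec τ)) j ∂Pr)
      = ∫ ω, (stackedRed (ZC ω))ᵀ.mulVec (V⁻¹.mulVec (y ω)) j ∂Pr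

/-- The population likelihood-ratio value
`L^R = E[l(β̄₀·1 + Z_k ζ̄ + Z_C τ̄; y)] − E[l(β̄₀^M·1 + Z_C τ̄^M; y)]`. -/
def LRval {m d c : ℕ} (Pr : Measure Ωs) (V : Matrix (Fin m) (Fin m) ℝ)
    (Zk : Ωs → Matrix (Fin m) (Fin d) ℝ) (ZC : Ωs → Matrix (Fin m) (Fin c) ℝ)
    (y : Ωs → Fin m → ℝ) (β0 : ℝ) (ζ : Fin d → ℝ) (τ : Fin c → ℝ)
    (β0M : ℝ) (τM : Fin c → ℝ) : ℝ :=
  (∫ ω, loglik V (pred (Zk ω) (ZC ω) β0 ζ τ) (y ω) ∂Pr)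
    - ∫ ω, loglik V (pred (Zk ω) (ZC ω) β0M 0 τM) (y ω) ∂Pr


/-- The spectral (operator) norm of a real square matrix, i.e. the operator norm of the
induced linear map on Euclidean space. -/
def specNorm {d : ℕ} (A : Matrix (Fin d) (Fin d) ℝ) : ℝ :=
  ‖Matrix.toEuclideanCLM (𝕜 := ℝ) A‖

/-- The Euclidean norm of a vector in `ℝ^d`. -/
def enorm' {d : ℕ} (v : Fin d → ℝ) : ℝ := Real.sqrt (∑ a, v a ^ 2)

/-- The reduced population Gram matrix `Ω₁₁ = E[[1, Z_C]ᵀ V⁻¹ [1, Z_C]]`. -/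
def gramRed {Ωs : Type*} [MeasurableSpace Ωs] {m c : ℕ} (Pr : Measure Ωs)
    (V : Matrix (Fin m) (Fin m) ℝ) (ZC : Ωs → Matrix (Fin m) (Fin c) ℝ) :
    Matrix (Unit ⊕ Fin c) (Unit ⊕ Fin c) ℝ :=
  Matrix.of fun j j' => ∫ ω, ((stackedRed (ZC ω))ᵀ * V⁻¹ * stackedRed (ZC ω)) j j' ∂Pr

/-- The block `Ω₂₂ = E[Z_kᵀ V⁻¹ Z_k]`. -/
def gramZk {Ωs : Type*} [MeasurableSpace Ωs] {m d : ℕ} (Pr : Measure Ωs)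
    (V : Matrix (Fin m) (Fin m) ℝ) (Zk : Ωs → Matrix (Fin m) (Fin d) ℝ) :
    Matrix (Fin d) (Fin d) ℝ :=
  Matrix.of fun a b' => ∫ ω, ((Zk ω)ᵀ * V⁻¹ * Zk ω) a b' ∂Pr


theorem aux_schur {d c : ℕ} (G : Matrix (Unit ⊕ Fin d ⊕ Fin c) (Unit ⊕ Fin d ⊕ Fin c) ℝ)
    (hsym : Gᵀ = G) (hpsd : ∀ v, 0 ≤ v ⬝ᵥ G *ᵥ v) (M : ℝ) (hM : 0 < M)
    (u : Unit ⊕ Fin d ⊕ Fin c → ℝ) (s : Fin d → ℝ)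
    (h1 : (G *ᵥ u) (Sum.inl ()) = 0) (h2 : ∀ b, (G *ᵥ u) (Sum.inr (Sum.inr b)) = 0)
    (h3 : ∀ a, (G *ᵥ u) (Sum.inr (Sum.inl a)) = s a)
    (hn : ∀ z : Fin d → ℝ, (Sum.elim (fun _ => 0) (Sum.elim z fun _ => 0)) ⬝ᵥ
      G *ᵥ (Sum.elim (fun _ => 0) (Sum.elim z fun _ => 0)) ≤ M * ∑ a, z a ^ 2) :
    ∑ a, s a ^ 2 ≤ M ^ 2 * ∑ a, u (Sum.inr (Sum.inl a)) ^ 2 := by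
  have hdot : ∀ v : Unit ⊕ Fin d ⊕ Fin c → ℝ,
      v ⬝ᵥ G *ᵥ u = ∑ a, v (Sum.inr (Sum.inl a)) * s a := by
    intro v
    simp [dotProduct, h1, h2, h3]
  have hcomm : ∀ v w : Unit ⊕ Fin d ⊕ Fin c → ℝ, v ⬝ᵥ G *ᵥ w = w ⬝ᵥ G *ᵥ v := by
    intro v w
    rw [dotProduct_mulVec, ← mulVec_transpose, hsym, dotProduct_comm]
  have hCS : ∀ z : Fin d → ℝ, (∑ a, z a * s a) ^ 2 ≤
      (∑ a, u (Sum.inr (Sum.inl a)) * s a) * (M * ∑ a, z a ^ 2) := by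
    intro z
    set e : Unit ⊕ Fin d ⊕ Fin c → ℝ := Sum.elim (fun _ => 0) (Sum.elim z fun _ => 0) with he
    have hb : e ⬝ᵥ G *ᵥ u = ∑ a, z a * s a := by rw [hdot]; simp [he]
    have ha : u ⬝ᵥ G *ᵥ u = ∑ a, u (Sum.inr (Sum.inl a)) * s a := hdot u
    have hq : ∀ t : ℝ, 0 ≤ (e ⬝ᵥ G *ᵥ e) * (t * t) + (2 * (e ⬝ᵥ G *ᵥ u)) * t
        + u ⬝ᵥ G *ᵥ u := by
      intro t
      have := hpsd (u + t • e)
      simp only [mulVec_add, mulVec_smul, dotProduct_add, add_dotProduct, smul_dotProduct,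
        dotProduct_smul, smul_eq_mul] at this
      rw [hcomm u e] at this
      linarith
    have hd := discrim_le_zero hq
    rw [discrim] at hd
    have h0 := hpsd u
    have := mul_le_mul_of_nonneg_left (hn z) h0
    rw [← ha, ← hb]
    nlinarith
  set Z := ∑ a, u (Sum.inr (Sum.inl a)) ^ 2 with hZ
  set p := ∑ a, u (Sum.inr (Sum.inl a)) * s a with hp
  set S := ∑ a, s a ^ 2 with hS
  have hZ0 : 0 ≤ Z := Finset.sum_nonneg fun _ _ => sq_nonneg _
  have hS0 : 0 ≤ S := Finset.sum_nonneg fun _ _ => sq_nonneg _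
  have hp0 : 0 ≤ p := by have := hpsd u; rwa [hdot] at this
  have hA : p ^ 2 ≤ p * (M * Z) := hCS fun a => u (Sum.inr (Sum.inl a))
  have hB : S ^ 2 ≤ p * (M * S) := by
    have := hCS s
    simpa only [← pow_two] using this
  have hA' : p ≤ M * Z := by
    rcases hp0.eq_or_lt with h | h
    · rw [← h]; positivity
    · rw [pow_two] at hA; exact le_of_mul_le_mul_left hA h
  rcases hS0.eq_or_lt with h | h
  · rw [← h]; positivity
  · have : S ≤ p * M := by
      refine le_of_mul_le_mul_left (a := S) ?_ h
      nlinarith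
    nlinarith

theorem aux_pred {m d c : ℕ} (Zk : Matrix (Fin m) (Fin d) ℝ) (ZC : Matrix (Fin m) (Fin c) ℝ)
    (β0 : ℝ) (ζ : Fin d → ℝ) (τ : Fin c → ℝ) :
    pred Zk ZC β0 ζ τ = stackedFull Zk ZC *ᵥ Sum.elim (fun _ => β0) (Sum.elim ζ τ) := by
  ext i
  simp [pred, stackedFull, mulVec, dotProduct, add_assoc]

theorem aux_spec {d : ℕ} (A : Matrix (Fin d) (Fin d) ℝ) (M : ℝ) (h : specNorm A ≤ M)
    (z : Fin d → ℝ) : z ⬝ᵥ A *ᵥ z ≤ M * ∑ a, z a ^ 2 := by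
  have e1 : z ⬝ᵥ A *ᵥ z = inner ℝ (WithLp.toLp 2 z)
      (Matrix.toEuclideanCLM (𝕜 := ℝ) A (WithLp.toLp 2 z)) := by
    simp [PiLp.inner_apply, dotProduct, mul_comm]
  have e2 : ∑ a, z a ^ 2 = ‖(WithLp.toLp 2 z : EuclideanSpace ℝ (Fin d))‖ ^ 2 := by
    simp [EuclideanSpace.norm_sq_eq]
  rw [e1, e2]
  refine (real_inner_le_norm _ _).trans ?_
  have h3 := (Matrix.toEuclideanCLM (𝕜 := ℝ) A).le_opNorm (WithLp.toLp 2 z)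
  have h4 : ‖Matrix.toEuclideanCLM (𝕜 := ℝ) A‖ ≤ M := h
  have h5 := norm_nonneg (WithLp.toLp 2 z : EuclideanSpace ℝ (Fin d))
  calc _ ≤ ‖(WithLp.toLp 2 z : EuclideanSpace ℝ (Fin d))‖ *
        (M * ‖(WithLp.toLp 2 z : EuclideanSpace ℝ (Fin d))‖) := by gcongr; exact h3.trans (by gcongr)
    _ = _ := by ring

/-- **Theorem 2** (Euclidean-norm version).  If `‖Ω₂₂‖ ≤ M` in spectral norm and the
marginal signal `‖E[Z_kᵀ V⁻¹ (fitted full − fitted reduced)]‖ ≥ c₀ √m n^{−κ}`, then under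
Condition A.8 the population likelihood-ratio value satisfies
`|L^R| ≥ (K̃ c₀² / M²) · m · n^{−2κ}`. -/
theorem theorem_two
    {Ωs : Type*} [MeasurableSpace Ωs] (Pr : Measure Ωs) [IsProbabilityMeasure Pr]
    {m d c : ℕ} (hm : 1 ≤ m) (hd : 1 ≤ d) (hc : 1 ≤ c)
    (V : Matrix (Fin m) (Fin m) ℝ) (hV : V.PosDef)
    (Zk : Ωs → Matrix (Fin m) (Fin d) ℝ) (ZC : Ωs → Matrix (Fin m) (Fin c) ℝ)
    (y : Ωs → Fin m → ℝ)
    (β0 : ℝ) (ζ : Fin d → ℝ) (τ : Fin c → ℝ) (β0M : ℝ) (τM : Fin c → ℝ)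
    -- (i) solutions of the full and reduced score equations, Ω₁₁ invertible
    (hfull : SolvesFull Pr V Zk ZC y β0 ζ τ)
    (hred : SolvesRed Pr V ZC y β0M τM)
    (hΩ11 : IsUnit (gramRed Pr V ZC).det)
    -- integrability ("enough integrability that all expectations are finite")
    (hIntGram : ∀ j j', Integrable
      (fun ω => ((stackedFull (Zk ω) (ZC ω))ᵀ * V⁻¹ * stackedFull (Zk ω) (ZC ω)) j j') Pr)
    (hIntY : ∀ j, Integrable
      (fun ω => (stackedFull (Zk ω) (ZC ω))ᵀ.mulVec (V⁻¹.mulVec (y ω)) j) Pr)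
    (hIntLL : ∀ (b' : ℝ) (z' : Fin d → ℝ) (t' : Fin c → ℝ),
      Integrable (fun ω => loglik V (pred (Zk ω) (ZC ω) b' z' t') (y ω)) Pr)
    -- (ii) Condition A.8 on a convex set containing both solutions
    (K : ℝ) (hK : 0 < K) (Zset : Set (ℝ × (Fin d → ℝ) × (Fin c → ℝ)))
    (hconv : Convex ℝ Zset)
    (hmem : (β0, ζ, τ) ∈ Zset) (hmemM : (β0M, 0, τM) ∈ Zset)
    (hA8 : ∀ P ∈ Zset,
      (∫ ω, loglik V (pred (Zk ω) (ZC ω) β0 ζ τ) (y ω) ∂Pr)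
          - (∫ ω, loglik V (pred (Zk ω) (ZC ω) P.1 P.2.1 P.2.2) (y ω) ∂Pr)
        ≥ K * ((P.1 - β0) ^ 2 + (∑ a, (P.2.1 a - ζ a) ^ 2) + ∑ b', (P.2.2 b' - τ b') ^ 2))
    -- quantitative hypotheses
    (M c0 κ : ℝ) (n : ℕ) (hM : 0 < M) (hc0 : 0 < c0)
    (hκ0 : 0 < κ) (hκ : κ < 1 / 2) (hn : 1 ≤ n)
    (hnorm : specNorm (gramZk Pr V Zk) ≤ M)
    (hsignal : c0 * Real.sqrt m * (n : ℝ) ^ (-κ) ≤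
      enorm' (fun a => ∫ ω, (Zk ω)ᵀ.mulVec (V⁻¹.mulVec
        (pred (Zk ω) (ZC ω) β0 ζ τ - pred (Zk ω) (ZC ω) β0M 0 τM)) a ∂Pr)) :
    (K * c0 ^ 2 / M ^ 2) * m * (n : ℝ) ^ (-(2 * κ)) ≤
      |LRval Pr V Zk ZC y β0 ζ τ β0M τM| := by
  set SF : Ωs → Matrix (Fin m) (Unit ⊕ Fin d ⊕ Fin c) ℝ := fun ω => stackedFull (Zk ω) (ZC ω)
    with hSF
  set G : Matrix (Unit ⊕ Fin d ⊕ Fin c) (Unit ⊕ Fin d ⊕ Fin c) ℝ :=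
    Matrix.of fun j j' => ∫ ω, ((SF ω)ᵀ * V⁻¹ * SF ω) j j' ∂Pr with hG
  have hVi : V⁻¹.PosDef := hV.inv
  have hVs : (V⁻¹)ᵀ = V⁻¹ := by
    have := hVi.isHermitian
    rwa [IsHermitian, conjTranspose_eq_transpose_of_trivial] at this
  have hexp : ∀ (u : Unit ⊕ Fin d ⊕ Fin c → ℝ) ω j,
      ((SF ω)ᵀ *ᵥ (V⁻¹ *ᵥ (SF ω *ᵥ u))) j = ∑ j', ((SF ω)ᵀ * V⁻¹ * SF ω) j j' * u j' := by
    intro u ω j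
    rw [mulVec_mulVec, mulVec_mulVec]
    simp only [mulVec, dotProduct, Matrix.mul_assoc]
  have hint : ∀ (u : Unit ⊕ Fin d ⊕ Fin c → ℝ) j,
      Integrable (fun ω => ((SF ω)ᵀ *ᵥ (V⁻¹ *ᵥ (SF ω *ᵥ u))) j) Pr := by
    intro u j
    simp only [hexp]
    exact integrable_finsetSum _ fun j' _ => (hIntGram j j').mul_const _
  have hGu : ∀ (u : Unit ⊕ Fin d ⊕ Fin c → ℝ) j,
      ∫ ω, ((SF ω)ᵀ *ᵥ (V⁻¹ *ᵥ (SF ω *ᵥ u))) j ∂Pr = (G *ᵥ u) j := by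
    intro u j
    simp only [hexp]
    rw [integral_finsetSum _ fun j' _ => (hIntGram j j').mul_const _]
    simp only [integral_mul_const]
    rfl
  have hsym : Gᵀ = G := by
    ext j j'
    simp only [hG, transpose_apply, of_apply]
    congr 1
    ext ω
    have hT : ((SF ω)ᵀ * V⁻¹ * SF ω)ᵀ = (SF ω)ᵀ * V⁻¹ * SF ω := by
      rw [transpose_mul, transpose_mul, hVs, transpose_transpose, Matrix.mul_assoc]
    exact congrFun (congrFun hT j) j'
  have hpsd : ∀ v, 0 ≤ v ⬝ᵥ G *ᵥ v := by
    intro v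
    have : v ⬝ᵥ G *ᵥ v = ∫ ω, (SF ω *ᵥ v) ⬝ᵥ V⁻¹ *ᵥ (SF ω *ᵥ v) ∂Pr := by
      have e : ∀ ω, (SF ω *ᵥ v) ⬝ᵥ V⁻¹ *ᵥ (SF ω *ᵥ v) =
          ∑ j, v j * ((SF ω)ᵀ *ᵥ (V⁻¹ *ᵥ (SF ω *ᵥ v))) j := by
        intro ω
        change _ = v ⬝ᵥ ((SF ω)ᵀ *ᵥ (V⁻¹ *ᵥ (SF ω *ᵥ v)))
        rw [dotProduct_mulVec v, vecMul_transpose]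
      simp only [e]
      rw [integral_finsetSum _ fun j _ => (hint v j).const_mul _]
      simp only [integral_const_mul, hGu]
      rfl
    rw [this]
    refine integral_nonneg fun ω => ?_
    have := hVi.posSemidef.dotProduct_mulVec_nonneg (SF ω *ᵥ v)
    simpa using this
  set uF : Unit ⊕ Fin d ⊕ Fin c → ℝ := Sum.elim (fun _ => β0) (Sum.elim ζ τ) with huF
  set uM : Unit ⊕ Fin d ⊕ Fin c → ℝ := Sum.elim (fun _ => β0M) (Sum.elim 0 τM) with huM
  have hF : ∀ j, (G *ᵥ uF) j = ∫ ω, ((SF ω)ᵀ *ᵥ (V⁻¹ *ᵥ (y ω))) j ∂Pr := by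
    intro j
    have := hfull j
    simp only [aux_pred] at this
    rw [← hGu]; exact this
  have hR : ∀ ω, (fun _ => β0M) + (ZC ω) *ᵥ τM = SF ω *ᵥ uM := by
    intro ω
    rw [hSF, huM, ← aux_pred]
    simp [pred]
  have hM1 : (G *ᵥ uM) (Sum.inl ()) = ∫ ω, ((SF ω)ᵀ *ᵥ (V⁻¹ *ᵥ (y ω))) (Sum.inl ()) ∂Pr := by
    have := hred (Sum.inl ())
    simp only [hR] at this
    rw [← hGu]; exact this
  have hM2 : ∀ b, (G *ᵥ uM) (Sum.inr (Sum.inr b)) =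
      ∫ ω, ((SF ω)ᵀ *ᵥ (V⁻¹ *ᵥ (y ω))) (Sum.inr (Sum.inr b)) ∂Pr := by
    intro b
    have := hred (Sum.inr b)
    simp only [hR] at this
    rw [← hGu]; exact this
  set s : Fin d → ℝ := fun a => ∫ ω, (Zk ω)ᵀ.mulVec (V⁻¹.mulVec
        (pred (Zk ω) (ZC ω) β0 ζ τ - pred (Zk ω) (ZC ω) β0M 0 τM)) a ∂Pr with hs
  have hkey := aux_schur G hsym hpsd M hM (uF - uM) s
    (by rw [mulVec_sub, Pi.sub_apply, hF, hM1, sub_self])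
    (by intro b; rw [mulVec_sub, Pi.sub_apply, hF, hM2, sub_self])
    (by
      intro a
      rw [← hGu, hs]
      simp only [aux_pred, ← mulVec_sub]
      rfl)
    (by
      intro z
      have := aux_spec _ M hnorm z
      refine le_trans (le_of_eq ?_) this
      simp only [dotProduct, mulVec, Fintype.sum_sum_type]
      simp
      rfl)
  have hA := hA8 _ hmemM
  simp only at hA
  have hz : ∑ a, (uF - uM) (Sum.inr (Sum.inl a)) ^ 2 = ∑ a, ζ a ^ 2 := by simp [huF, huM]
  rw [hz] at hkey
  have hL : K * ∑ a, ζ a ^ 2 ≤ LRval Pr V Zk ZC y β0 ζ τ β0M τM := by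
    unfold LRval
    refine le_trans ?_ hA
    have h1 : 0 ≤ ∑ b', (τM b' - τ b') ^ 2 := Finset.sum_nonneg fun _ _ => sq_nonneg _
    have h2 : ∑ a, ((0 : Fin d → ℝ) a - ζ a) ^ 2 = ∑ a, ζ a ^ 2 := by simp
    rw [h2]
    gcongr
    nlinarith [sq_nonneg (β0M - β0)]
  refine le_trans ?_ (hL.trans (le_abs_self _))
  have hsq : (c0 * Real.sqrt m * (n : ℝ) ^ (-κ)) ^ 2 ≤ ∑ a, s a ^ 2 := by
    have h0 : 0 ≤ c0 * Real.sqrt m * (n : ℝ) ^ (-κ) := by positivity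
    have := pow_le_pow_left₀ h0 hsignal 2
    rwa [enorm', Real.sq_sqrt (Finset.sum_nonneg fun _ _ => sq_nonneg _)] at this
  have hpow : ((n : ℝ) ^ (-κ)) ^ 2 = (n : ℝ) ^ (-(2 * κ)) := by
    rw [← Real.rpow_natCast, ← Real.rpow_mul (by positivity)]
    congr 1; push_cast; ring
  rw [mul_pow, mul_pow, Real.sq_sqrt (by positivity), hpow] at hsq
  have hfin := hsq.trans hkey
  have : (K * c0 ^ 2 / M ^ 2) * m * (n : ℝ) ^ (-(2 * κ)) =
      K * ((c0 ^ 2 * m * (n : ℝ) ^ (-(2 * κ))) / M ^ 2) := by ring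
  rw [this]
  gcongr
  rw [div_le_iff₀ (by positivity)]
  linarith
end
end

section
/- Assume the full score equations have a solution (β̄₀, ζ̄, τ̄), the reduced score equations have a solution (β̄₀^M, τ̄^M), and the matrix Ω₁₁ is invertible. Set β̌₀ = β̄₀ − β̄₀^M and τ̌ = τ̄ − τ̄^M. Then: (a) the vector (β̌₀, τ̌) ∈ ℝ^{1+c} equals −Ω₁₁⁻¹ Ω₁₂ ζ̄; and (b) E[Z_kᵀ V⁻¹ (β̌₀·1_m + Z_C τ̌ + Z_k ζ̄)] = (Ω₂₂ − Ω₂₁ Ω₁₁⁻¹ Ω₁₂)·ζ̄. Equivalently, the difference of the fitted linear predictors satisfies E[Z_kᵀ V⁻¹ ((β̄₀·1_m + Z_k ζ̄ + Z_C τ̄) − (β̄₀^M·1_m + Z_C τ̄^M))] = (Ω₂₂ − Ω₂₁ Ω₁₁⁻¹ Ω₁₂)·ζ̄, where Ω₂₂ − Ω₂₁ Ω₁₁⁻¹ Ω₁₂ is the Schur complement of Ω₁₁ in the full Gram matrix. -/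
open MeasureTheory Matrix Real

noncomputable section

variable {Ωs : Type*} [MeasurableSpace Ωs]

/-- The cross block `Ω₁₂ = E[[1, Z_C]ᵀ V⁻¹ Z_k]`. -/
def gramCross {Ωs : Type*} [MeasurableSpace Ωs] {m d c : ℕ} (Pr : Measure Ωs)
    (V : Matrix (Fin m) (Fin m) ℝ)
    (Zk : Ωs → Matrix (Fin m) (Fin d) ℝ) (ZC : Ωs → Matrix (Fin m) (Fin c) ℝ) :
    Matrix (Unit ⊕ Fin c) (Fin d) ℝ :=
  Matrix.of fun j a => ∫ ω, ((stackedRed (ZC ω))ᵀ * V⁻¹ * Zk ω) j a ∂Pr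

theorem integral_aux {Ωs : Type*} [MeasurableSpace Ωs] (Pr : Measure Ωs) {m : ℕ}
    {p q : Type*} [Fintype q]
    (W : Matrix (Fin m) (Fin m) ℝ) (A : Ωs → Matrix (Fin m) p ℝ) (B : Ωs → Matrix (Fin m) q ℝ)
    (h : ∀ j j', Integrable (fun ω => ((A ω)ᵀ * W * B ω) j j') Pr) (v : q → ℝ) (j : p) :
    Integrable (fun ω => (A ω)ᵀ.mulVec (W.mulVec ((B ω).mulVec v)) j) Pr ∧
    (∫ ω, (A ω)ᵀ.mulVec (W.mulVec ((B ω).mulVec v)) j ∂Pr)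
      = (Matrix.of fun j j' => ∫ ω, ((A ω)ᵀ * W * B ω) j j' ∂Pr).mulVec v j := by
  have e : (fun ω => (A ω)ᵀ.mulVec (W.mulVec ((B ω).mulVec v)) j)
      = fun ω => ∑ k, ((A ω)ᵀ * W * B ω) j k * v k := by
    funext ω
    rw [Matrix.mulVec_mulVec, Matrix.mulVec_mulVec]
    rfl
  rw [e]
  refine ⟨integrable_finsetSum _ fun k _ => (h j k).mul_const _, ?_⟩
  rw [integral_finsetSum _ fun k _ => (h j k).mul_const _]
  simp only [integral_mul_const]
  rfl

theorem red_mulVec {m c : ℕ} (ZC : Matrix (Fin m) (Fin c) ℝ) (b : ℝ) (t : Fin c → ℝ) :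
    (fun _ => b) + ZC.mulVec t = (stackedRed ZC).mulVec (Sum.elim (fun _ : Unit => b) t) := by
  funext i
  simp [stackedRed, Matrix.mulVec, dotProduct]

/-- With `β̌₀ = β̄₀ − β̄₀^M` and `τ̌ = τ̄ − τ̄^M`:
(a) `(β̌₀, τ̌) = −Ω₁₁⁻¹ Ω₁₂ ζ̄`, and
(b) `E[Z_kᵀ V⁻¹ (β̌₀·1 + Z_C τ̌ + Z_k ζ̄)] = (Ω₂₂ − Ω₂₁ Ω₁₁⁻¹ Ω₁₂) ζ̄`, equivalently, the same
identity holds for the difference of the fitted linear predictors. -/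
theorem score_difference_schur
    {Ωs : Type*} [MeasurableSpace Ωs] (Pr : Measure Ωs) [IsProbabilityMeasure Pr]
    {m d c : ℕ} (hm : 1 ≤ m) (hd : 1 ≤ d) (hc : 1 ≤ c)
    (V : Matrix (Fin m) (Fin m) ℝ) (hV : V.PosDef)
    (Zk : Ωs → Matrix (Fin m) (Fin d) ℝ) (ZC : Ωs → Matrix (Fin m) (Fin c) ℝ)
    (y : Ωs → Fin m → ℝ)
    (β0 : ℝ) (ζ : Fin d → ℝ) (τ : Fin c → ℝ) (β0M : ℝ) (τM : Fin c → ℝ)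
    (hfull : SolvesFull Pr V Zk ZC y β0 ζ τ)
    (hred : SolvesRed Pr V ZC y β0M τM)
    (hΩ11 : IsUnit (gramRed Pr V ZC).det)
    -- integrability ("enough integrability that all expectations are finite")
    (hIntGram : ∀ j j', Integrable
      (fun ω => ((stackedFull (Zk ω) (ZC ω))ᵀ * V⁻¹ * stackedFull (Zk ω) (ZC ω)) j j') Pr)
    (hIntY : ∀ j, Integrable
      (fun ω => (stackedFull (Zk ω) (ZC ω))ᵀ.mulVec (V⁻¹.mulVec (y ω)) j) Pr) :
    -- (a)
    (Sum.elim (fun _ : Unit => β0 - β0M) (fun b' => τ b' - τM b')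
        = -((gramRed Pr V ZC)⁻¹ * gramCross Pr V Zk ZC).mulVec ζ) ∧
    -- (b)
    ((fun a => ∫ ω, (Zk ω)ᵀ.mulVec (V⁻¹.mulVec
          ((fun _ => β0 - β0M) + (ZC ω).mulVec (τ - τM) + (Zk ω).mulVec ζ)) a ∂Pr)
        = (gramZk Pr V Zk
            - (gramCross Pr V Zk ZC)ᵀ * (gramRed Pr V ZC)⁻¹ * gramCross Pr V Zk ZC).mulVec ζ) ∧
    -- equivalently, in terms of the difference of fitted linear predictors
    ((fun a => ∫ ω, (Zk ω)ᵀ.mulVec (V⁻¹.mulVec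
          (pred (Zk ω) (ZC ω) β0 ζ τ - pred (Zk ω) (ZC ω) β0M 0 τM)) a ∂Pr)
        = (gramZk Pr V Zk
            - (gramCross Pr V Zk ZC)ᵀ * (gramRed Pr V ZC)⁻¹ * gramCross Pr V Zk ZC).mulVec ζ) := by
  have hVi : (V⁻¹)ᵀ = V⁻¹ := by
    have := hV.isHermitian.inv
    simpa [Matrix.IsHermitian, Matrix.conjTranspose_eq_transpose_of_trivial] using this
  let e : Unit ⊕ Fin c → Unit ⊕ Fin d ⊕ Fin c := Sum.elim Sum.inl (fun b => Sum.inr (Sum.inr b))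
  have hSe : ∀ ω j i, stackedRed (ZC ω) i j = stackedFull (Zk ω) (ZC ω) i (e j) := by
    rintro ω (j | j) i <;> rfl
  have hKe : ∀ ω j i, Zk ω i j = stackedFull (Zk ω) (ZC ω) i (Sum.inr (Sum.inl j)) := by
    intro ω j i; rfl
  have h11 : ∀ j j', Integrable
      (fun ω => ((stackedRed (ZC ω))ᵀ * V⁻¹ * stackedRed (ZC ω)) j j') Pr := by
    intro j j'
    have := hIntGram (e j) (e j')
    simpa only [Matrix.mul_apply, Matrix.transpose_apply, ← hSe] using this
  have h12 : ∀ j j', Integrable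
      (fun ω => ((stackedRed (ZC ω))ᵀ * V⁻¹ * Zk ω) j j') Pr := by
    intro j j'
    have := hIntGram (e j) (Sum.inr (Sum.inl j'))
    simpa only [Matrix.mul_apply, Matrix.transpose_apply, ← hSe, ← hKe] using this
  have h21 : ∀ j j', Integrable
      (fun ω => ((Zk ω)ᵀ * V⁻¹ * stackedRed (ZC ω)) j j') Pr := by
    intro j j'
    have := hIntGram (Sum.inr (Sum.inl j)) (e j')
    simpa only [Matrix.mul_apply, Matrix.transpose_apply, ← hSe, ← hKe] using this
  have h22 : ∀ j j', Integrable
      (fun ω => ((Zk ω)ᵀ * V⁻¹ * Zk ω) j j') Pr := by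
    intro j j'
    have := hIntGram (Sum.inr (Sum.inl j)) (Sum.inr (Sum.inl j'))
    simpa only [Matrix.mul_apply, Matrix.transpose_apply, ← hKe] using this
  have hT : (Matrix.of fun j j' => ∫ ω, ((Zk ω)ᵀ * V⁻¹ * stackedRed (ZC ω)) j j' ∂Pr)
      = (gramCross Pr V Zk ZC)ᵀ := by
    ext a j
    simp only [gramCross, Matrix.of_apply, Matrix.transpose_apply]
    congr 1
    funext ω
    have : ((Zk ω)ᵀ * V⁻¹ * stackedRed (ZC ω)) = ((stackedRed (ZC ω))ᵀ * V⁻¹ * Zk ω)ᵀ := by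
      rw [Matrix.transpose_mul, Matrix.transpose_mul, hVi, Matrix.transpose_transpose,
        Matrix.mul_assoc]
    rw [this]; rfl
  have hpred : ∀ ω b z t, pred (Zk ω) (ZC ω) b z t
      = (stackedRed (ZC ω)).mulVec (Sum.elim (fun _ : Unit => b) t) + (Zk ω).mulVec z := by
    intro ω b z t
    rw [← red_mulVec, pred]; abel
  set u : Unit ⊕ Fin c → ℝ := Sum.elim (fun _ : Unit => β0) τ with hu
  set uM : Unit ⊕ Fin c → ℝ := Sum.elim (fun _ : Unit => β0M) τM with huM
  have hdiff : Sum.elim (fun _ : Unit => β0 - β0M) (fun b' => τ b' - τM b') = u - uM := by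
    funext j; rcases j with j | j <;> rfl
  have key : (gramRed Pr V ZC).mulVec u + (gramCross Pr V Zk ZC).mulVec ζ
      = (gramRed Pr V ZC).mulVec uM := by
    funext j
    have f := hfull (e j)
    have r := hred j
    have rows : ∀ ω (w : Fin m → ℝ), (stackedFull (Zk ω) (ZC ω))ᵀ.mulVec w (e j)
        = (stackedRed (ZC ω))ᵀ.mulVec w j := by
      intro ω w
      simp only [Matrix.mulVec, dotProduct, Matrix.transpose_apply, ← hSe]
    simp only [rows] at f
    rw [← r] at f
    simp only [hpred, red_mulVec, Matrix.mulVec_add, Pi.add_apply] at f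
    rw [integral_add (integral_aux Pr V⁻¹ _ _ h11 _ j).1 (integral_aux Pr V⁻¹ _ _ h12 _ j).1,
      (integral_aux Pr V⁻¹ _ _ h11 _ j).2, (integral_aux Pr V⁻¹ _ _ h12 _ j).2,
      (integral_aux Pr V⁻¹ _ _ h11 _ j).2] at f
    exact f
  have hA : u - uM = -((gramRed Pr V ZC)⁻¹ * gramCross Pr V Zk ZC).mulVec ζ := by
    have k2 : (gramRed Pr V ZC).mulVec (u - uM) = -(gramCross Pr V Zk ZC).mulVec ζ := by
      rw [Matrix.mulVec_sub, ← key]; abel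
    rw [← Matrix.mulVec_mulVec, ← Matrix.mulVec_neg, ← k2, Matrix.mulVec_mulVec,
      Matrix.nonsing_inv_mul _ hΩ11, Matrix.one_mulVec]
  have hB : (fun a => ∫ ω, (Zk ω)ᵀ.mulVec (V⁻¹.mulVec
          ((stackedRed (ZC ω)).mulVec (u - uM) + (Zk ω).mulVec ζ)) a ∂Pr)
        = (gramZk Pr V Zk
            - (gramCross Pr V Zk ZC)ᵀ * (gramRed Pr V ZC)⁻¹ * gramCross Pr V Zk ZC).mulVec ζ := by
    funext a
    simp only [Matrix.mulVec_add, Pi.add_apply]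
    rw [integral_add (integral_aux Pr V⁻¹ _ _ h21 _ a).1 (integral_aux Pr V⁻¹ _ _ h22 _ a).1,
      (integral_aux Pr V⁻¹ _ _ h21 _ a).2, (integral_aux Pr V⁻¹ _ _ h22 _ a).2, hT, hA,
      Matrix.sub_mulVec, Matrix.mulVec_neg, Matrix.mulVec_mulVec, ← Matrix.mul_assoc]
    simp only [Pi.sub_apply, Pi.neg_apply, gramZk]
    ring
  refine ⟨hdiff.trans hA, ?_, ?_⟩
  · rw [← hB]
    funext a
    simp only [red_mulVec]
    rw [← hdiff]
    rfl
  · rw [← hB]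
    funext a
    congr 1
    funext ω
    have : pred (Zk ω) (ZC ω) β0 ζ τ - pred (Zk ω) (ZC ω) β0M 0 τM
        = (stackedRed (ZC ω)).mulVec (u - uM) + (Zk ω).mulVec ζ := by
      rw [hpred, hpred, Matrix.mulVec_zero, add_zero, Matrix.mulVec_sub]
      abel
    rw [this]
end
end

section
/- Let m ≥ 1 and ρ ∈ ℝ with ρ ≠ 1 and 1 + (m−1)·ρ ≠ 0, and let R = (1−ρ)·I_m + ρ·1_m 1_mᵀ ∈ ℝ^{m×m} be the compound symmetry (exchangeable) correlation matrix with unit diagonal and off-diagonal entries ρ. Then R is invertible and R⁻¹ 1_m = (1 + (m−1)·ρ)⁻¹ · 1_m. Consequently, for any vector y ∈ ℝ^m and any matrix X ∈ ℝ^{m×p} all of whose columns are constant vectors (i.e., X = 1_m xᵀ for some x ∈ ℝ^p), one has Xᵀ R⁻¹ y = (1 + (m−1)·ρ)⁻¹ · Xᵀ y; that is, the compound-symmetry screening statistic is a positive scalar multiple of the independence (identity working correlation) screening statistic whenever the covariates are baseline-only (constant within subject). -/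
/-!
Statement 11: the compound symmetry correlation matrix `R = (1−ρ)I + ρ 1 1ᵀ` is invertible
(when `ρ ≠ 1` and `1 + (m−1)ρ ≠ 0`), satisfies `R⁻¹ 1 = (1 + (m−1)ρ)⁻¹ 1`, and hence for
baseline-only covariates the compound-symmetry screening statistic is a scalar multiple of
the independence screening statistic.
-/

open Matrix

theorem compound_symmetry_screening_equivalence
    {m : ℕ} (hm : 1 ≤ m) (ρ : ℝ) (hρ1 : ρ ≠ 1) (hρ2 : 1 + ((m : ℝ) - 1) * ρ ≠ 0)
    (R : Matrix (Fin m) (Fin m) ℝ)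
    (hR : R = (1 - ρ) • (1 : Matrix (Fin m) (Fin m) ℝ)
        + ρ • (Matrix.of fun _ _ => (1 : ℝ))) :
    IsUnit R.det ∧
    R⁻¹.mulVec (fun _ => (1 : ℝ)) = (1 + ((m : ℝ) - 1) * ρ)⁻¹ • (fun _ => (1 : ℝ)) ∧
    ∀ (p : ℕ) (y : Fin m → ℝ) (x : Fin p → ℝ),
      (Matrix.of fun (_ : Fin m) (j : Fin p) => x j)ᵀ.mulVec (R⁻¹.mulVec y)
        = (1 + ((m : ℝ) - 1) * ρ)⁻¹
            • ((Matrix.of fun (_ : Fin m) (j : Fin p) => x j)ᵀ.mulVec y) := by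
  set J : Matrix (Fin m) (Fin m) ℝ := Matrix.of fun _ _ => (1 : ℝ) with hJ
  have h1 : (1 - ρ) ≠ 0 := sub_ne_zero.mpr (Ne.symm hρ1)
  have hJJ : J * J = (m : ℝ) • J := by
    ext i j
    simp [hJ, Matrix.mul_apply]
  have hmul : R * ((1 - ρ)⁻¹ • ((1 : Matrix (Fin m) (Fin m) ℝ)
      - (ρ * (1 + ((m : ℝ) - 1) * ρ)⁻¹) • J)) = 1 := by
    rw [hR]
    simp only [Matrix.mul_smul, Matrix.mul_sub, Matrix.add_mul, Matrix.smul_mul, hJJ,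
      Matrix.one_mul, Matrix.mul_one]
    ext i j
    simp only [Matrix.smul_apply, Matrix.sub_apply, Matrix.add_apply, smul_eq_mul]
    have hc := mul_inv_cancel₀ hρ2
    have hb := mul_inv_cancel₀ h1
    generalize (1 + ((m : ℝ) - 1) * ρ)⁻¹ = c at hc ⊢
    field_simp
    linear_combination (-ρ * J i j) * hc
  have hdet : IsUnit R.det := by
    have := congrArg Matrix.det hmul
    rw [Matrix.det_mul, Matrix.det_one] at this
    exact IsUnit.of_mul_eq_one _ this
  have hR1 : R.mulVec (fun _ => (1 : ℝ)) = (1 + ((m : ℝ) - 1) * ρ) • (fun _ => (1 : ℝ)) := by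
    rw [hR, Matrix.add_mulVec, Matrix.smul_mulVec, Matrix.smul_mulVec, Matrix.one_mulVec]
    ext i
    simp [hJ, Matrix.mulVec, dotProduct]
    ring
  refine ⟨hdet, ?_, ?_⟩
  · have h := congrArg (R⁻¹.mulVec) hR1
    rw [Matrix.mulVec_mulVec, Matrix.nonsing_inv_mul _ hdet, Matrix.one_mulVec,
      Matrix.mulVec_smul] at h
    rw [eq_inv_smul_iff₀ hρ2]
    exact h.symm
  · intro p y x
    set X : Matrix (Fin m) (Fin p) ℝ := Matrix.of fun _ j => x j with hX
    have hXR : Xᵀ * R = (1 + ((m : ℝ) - 1) * ρ) • Xᵀ := by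
      rw [hR, Matrix.mul_add, Matrix.mul_smul, Matrix.mul_smul, Matrix.mul_one]
      ext i j
      simp [hJ, hX, Matrix.mul_apply]
      ring
    rw [eq_inv_smul_iff₀ hρ2, ← Matrix.smul_mulVec, ← hXR, Matrix.mulVec_mulVec,
      Matrix.mul_assoc, Matrix.mul_nonsing_inv _ hdet, Matrix.mul_one]
end
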